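/- Let 0 < p ≤ 2 and let f be the martingale constructed from (α_k). Then there exists an absolute constant c > 0 such that for every k ≥ 1, Σ_{l=1}^{M_{α_k+1}−1} |f̂(l)|^p Φ_l / l^{2−p} ≥ c · Φ_{M_{α_k}}^{1/2}; in particular, since Φ_n → ∞, Σ_{l=1}^∞ |f̂(l)|^p Φ_l / l^{2−p} = ∞. -/

import Mathlib

open MeasureTheory Filter Finset
open scoped Classical ENNReal NNReal

noncomputable section

namespace VilenkinPaper

/-- The generalized powers `M_0 = 1`, `M_{k+1} = m_k M_k`. -/
def Mseq (m : ℕ → ℕ) : ℕ → ℕ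
  | 0 => 1
  | k + 1 => m k * Mseq m k

/-- The Vilenkin group `G_m = ∏_k ℤ_{m_k}`. -/
abbrev Gm (m : ℕ → ℕ) : Type := (k : ℕ) → ZMod (m k)

/-- The `j`-th digit of `n` in the generalized number system based on `m`. -/
def digit (m : ℕ → ℕ) (n j : ℕ) : ℕ := n / Mseq m j % m j

/-- The generalized Rademacher functions `r_k(x) = exp(2πi x_k / m_k)`. -/
def rad (m : ℕ → ℕ) (k : ℕ) (x : Gm m) : ℂ :=
  Complex.exp (2 * Real.pi * Complex.I * ((x k).val : ℂ) / (m k : ℂ))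

/-- The Vilenkin system `ψ_n = ∏_k r_k^{n_k}`. -/
def psi (m : ℕ → ℕ) (n : ℕ) (x : Gm m) : ℂ := ∏ᶠ k : ℕ, rad m k x ^ digit m n k

/-- The Dirichlet kernels `D_n = ∑_{k<n} ψ_k`. -/
def Dker (m : ℕ → ℕ) (n : ℕ) (x : Gm m) : ℂ := ∑ k ∈ Finset.range n, psi m k x

/-- The interval `I_n(x)` : all `y` agreeing with `x` on the first `n` coordinates. -/
def Iset (m : ℕ → ℕ) (n : ℕ) (x : Gm m) : Set (Gm m) := {y | ∀ k < n, y k = x k}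

/-- `I_n := I_n(0)`. -/
def IsetO (m : ℕ → ℕ) (n : ℕ) : Set (Gm m) := Iset m n 0

/-- `μ` is the normalized Haar (product) measure iff every interval `I_n(x)` has
measure `1 / M_n`. -/
def IsHaarGm (m : ℕ → ℕ) (μ : Measure (Gm m)) : Prop :=
  ∀ n x, μ (Iset m n x) = ((Mseq m n : ℝ≥0∞))⁻¹

/-- The σ-algebra `F_n` generated by the intervals `{I_n(x)}`, i.e. by the first `n`
coordinates. -/
def filt (m : ℕ → ℕ) (n : ℕ) : MeasurableSpace (Gm m) :=
  MeasurableSpace.comap (fun x (k : Fin n) => x k) ⊤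

/-- A (Vilenkin) martingale with respect to the filtration `F_n`. -/
def IsVMartingale (m : ℕ → ℕ) (μ : Measure (Gm m)) (f : ℕ → Gm m → ℂ) : Prop :=
  (∀ n, Integrable (f n) μ) ∧
  (∀ n, Measurable[filt m n] (f n)) ∧
  (∀ n N, n ≤ N → μ[f N | filt m n] =ᵐ[μ] f n)

/-- Membership in the martingale Hardy space `H_p`: the maximal function
`f* = sup_n |f^{(n)}|` belongs to `L_p`. -/
def MemHp (m : ℕ → ℕ) (μ : Measure (Gm m)) (p : ℝ) (f : ℕ → Gm m → ℂ) : Prop :=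
  ∫⁻ x, (⨆ n, (‖f n x‖₊ : ℝ≥0∞)) ^ p ∂μ < ⊤

/-- The `i`-th Vilenkin–Fourier coefficient of an integrable function. -/
def fourierCoefFn (m : ℕ → ℕ) (μ : Measure (Gm m)) (g : Gm m → ℂ) (i : ℕ) : ℂ :=
  ∫ x, g x * (starRingEnd ℂ) (psi m i x) ∂μ

/-- The partial sum `S_n` built from a sequence `c` of Fourier coefficients. -/
def Spart (m : ℕ → ℕ) (c : ℕ → ℂ) (n : ℕ) (x : Gm m) : ℂ :=
  ∑ k ∈ Finset.range n, c k * psi m k x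

/-- The weak `L_{p,∞}` quasinorm `sup_{λ>0} λ μ(|g| > λ)^{1/p}`. -/
def wLp (m : ℕ → ℕ) (μ : Measure (Gm m)) (p : ℝ) (g : Gm m → ℂ) : ℝ≥0∞ :=
  ⨆ (t : ℝ) (_ : 0 < t), ENNReal.ofReal t * μ {x | t < ‖g x‖} ^ (1 / p)

/-- `|n| = max {j : n_j ≠ 0}`. -/
def maxDigit (m : ℕ → ℕ) (n : ℕ) : ℕ := sSup {j | digit m n j ≠ 0}

/-- The set `ℕ_{n_0}` of positive integers with `n_0 = n_{|n|} = 1`. -/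
def Nn0 (m : ℕ → ℕ) : Set ℕ :=
  {n | 0 < n ∧ digit m n 0 = 1 ∧ digit m n (maxDigit m n) = 1}

/-- The atom `a = (M_α^{1/p-1}/M) (D_{M_{α+1}} - D_{M_α})`. -/
def atomFun (m : ℕ → ℕ) (MM : ℕ) (p : ℝ) (a : ℕ) (x : Gm m) : ℂ :=
  (((Mseq m a : ℝ) ^ (1 / p - 1) / (MM : ℝ) : ℝ) : ℂ) *
    (Dker m (Mseq m (a + 1)) x - Dker m (Mseq m a) x)

/-- The coefficients `λ_k = Φ_{M_{α_k}}^{-1/4}`. -/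
def lamSeq (m : ℕ → ℕ) (Φ : ℕ → ℝ) (α : ℕ → ℕ) (k : ℕ) : ℝ :=
  Φ (Mseq m (α k)) ^ (-(1 / 4 : ℝ))

/-- The martingale `f^{(A)} = ∑_{k : α_k < A} λ_k a_k` of the counterexample construction. -/
def fCon (m : ℕ → ℕ) (MM : ℕ) (p : ℝ) (Φ : ℕ → ℝ) (α : ℕ → ℕ) (A : ℕ) (x : Gm m) : ℂ :=
  ∑ᶠ (k : ℕ) (_ : α k < A), (lamSeq m Φ α k : ℂ) * atomFun m MM p (α k) x

section Mseq

variable {m : ℕ → ℕ}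

lemma Mseq_succ (m : ℕ → ℕ) (k : ℕ) : Mseq m (k + 1) = m k * Mseq m k := rfl

lemma Mseq_pos (hm : ∀ k, 2 ≤ m k) (n : ℕ) : 0 < Mseq m n := by
  induction n with
  | zero => exact one_pos
  | succ k ih => exact Nat.mul_pos (by have := hm k; omega) ih

lemma Mseq_strictMono (hm : ∀ k, 2 ≤ m k) : StrictMono (Mseq m) := by
  refine strictMono_nat_of_lt_succ fun k => ?_
  rw [Mseq_succ]
  nlinarith [hm k, Mseq_pos hm k]

lemma lt_Mseq (hm : ∀ k, 2 ≤ m k) (n : ℕ) : n < Mseq m n := by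
  induction n with
  | zero => exact one_pos
  | succ k ih => exact lt_of_le_of_lt ih (Mseq_strictMono hm (Nat.lt_succ_self k))

lemma prod_range_eq_Mseq (m : ℕ → ℕ) (N : ℕ) : ∏ k ∈ range N, m k = Mseq m N := by
  induction N with
  | zero => rfl
  | succ k ih => rw [prod_range_succ, ih, Mseq_succ, mul_comm]

lemma digit_eq_zero_of_lt (hm : ∀ k, 2 ≤ m k) {n N k : ℕ} (hn : n < Mseq m N) (hk : N ≤ k) :
    digit m n k = 0 := by
  rw [digit, Nat.div_eq_of_lt (hn.trans_le ((Mseq_strictMono hm).monotone hk)), Nat.zero_mod]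

lemma digit_lt (hm : ∀ k, 2 ≤ m k) (n k : ℕ) : digit m n k < m k :=
  Nat.mod_lt _ (by have := hm k; omega)

/-- The residue of `n` modulo `M_N` is determined by the first `N` digits of `n`. -/
lemma mod_Mseq_eq_sum_digit (m : ℕ → ℕ) (n N : ℕ) :
    n % Mseq m N = ∑ k ∈ range N, digit m n k * Mseq m k := by
  induction N with
  | zero => simp [Mseq, Nat.mod_one]
  | succ k ih =>
    rw [sum_range_succ, ← ih, Mseq_succ, mul_comm (m k), Nat.mod_mul, digit, mul_comm (Mseq m k)]

lemma exists_digit_ne {l i N : ℕ} (hl : l < Mseq m N) (hi : i < Mseq m N) (h : l ≠ i) :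
    ∃ k < N, digit m l k ≠ digit m i k := by
  by_contra! H
  apply h
  rw [← Nat.mod_eq_of_lt hl, ← Nat.mod_eq_of_lt hi, mod_Mseq_eq_sum_digit, mod_Mseq_eq_sum_digit]
  exact sum_congr rfl fun k hk => by rw [H k (mem_range.1 hk)]

end Mseq

section Orthonormality

variable {m : ℕ → ℕ}

lemma psi_eq_prod_fin (hm : ∀ k, 2 ≤ m k) {n N : ℕ} (hn : n < Mseq m N) (x : Gm m) :
    psi m n x = ∏ k : Fin N, rad m k x ^ digit m n k := by
  rw [psi, Fin.prod_univ_eq_prod_range (fun k => rad m k x ^ digit m n k),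
    finprod_eq_prod_of_mulSupport_subset]
  intro k hk
  by_contra hkN
  have hkN : N ≤ k := by simpa using hkN
  exact hk (by simp [digit_eq_zero_of_lt hm hn hkN])

/-- The projection of `G_m` onto its first `N` coordinates. -/
def firstCoords (m : ℕ → ℕ) (N : ℕ) (x : Gm m) (k : Fin N) : ZMod (m k) := x k

lemma measurable_firstCoords (m : ℕ → ℕ) (N : ℕ) : Measurable (firstCoords m N) :=
  measurable_pi_lambda _ fun k => measurable_pi_apply (k : ℕ)

lemma IsHaarGm.isProbabilityMeasure {μ : Measure (Gm m)} (hμ : IsHaarGm m μ) :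
    IsProbabilityMeasure μ := by
  constructor
  have h := hμ 0 0
  have hI : Iset m 0 0 = Set.univ := by simp [Iset]
  simpa [hI, Mseq] using h

lemma IsHaarGm.map_firstCoords_singleton {μ : Measure (Gm m)} (hμ : IsHaarGm m μ) (N : ℕ)
    (y : (k : Fin N) → ZMod (m k)) :
    μ.map (firstCoords m N) {y} = (Mseq m N : ℝ≥0∞)⁻¹ := by
  rw [Measure.map_apply (measurable_firstCoords m N) (measurableSet_singleton y),
    ← hμ N fun k => if h : k < N then y ⟨k, h⟩ else 0]
  congr 1
  ext x
  simp only [Set.mem_preimage, Set.mem_singleton_iff, Iset, Set.mem_ofPred_eq, firstCoords,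
    funext_iff]
  constructor
  · intro h k hk
    simpa [hk] using h ⟨k, hk⟩
  · intro h k
    simpa using h k k.2

lemma IsHaarGm.integrable_comp_firstCoords [∀ k, NeZero (m k)] {μ : Measure (Gm m)}
    (hμ : IsHaarGm m μ) (N : ℕ) (g : ((k : Fin N) → ZMod (m k)) → ℂ) :
    Integrable (fun x => g (firstCoords m N x)) μ := by
  have := hμ.isProbabilityMeasure
  have := Measure.isProbabilityMeasure_map (μ := μ) (measurable_firstCoords m N).aemeasurable
  exact (Integrable.of_finite (μ := μ.map (firstCoords m N)) (f := g)).comp_measurable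
    (measurable_firstCoords m N)

lemma IsHaarGm.integral_comp_firstCoords [∀ k, NeZero (m k)] {μ : Measure (Gm m)}
    (hμ : IsHaarGm m μ) (N : ℕ) (g : ((k : Fin N) → ZMod (m k)) → ℂ) :
    ∫ x, g (firstCoords m N x) ∂μ = (Mseq m N : ℂ)⁻¹ * ∑ y, g y := by
  have := hμ.isProbabilityMeasure
  have := Measure.isProbabilityMeasure_map (μ := μ) (measurable_firstCoords m N).aemeasurable
  rw [← integral_map (measurable_firstCoords m N).aemeasurable
    (measurable_of_finite g).aestronglyMeasurable, integral_fintype Integrable.of_finite, mul_sum]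
  refine sum_congr rfl fun y _ => ?_
  rw [Measure.real, hμ.map_firstCoords_singleton]
  simp

lemma rad_eq_stdAddChar [∀ k, NeZero (m k)] (k : ℕ) (x : Gm m) :
    rad m k x = ZMod.stdAddChar (x k) := by
  rw [ZMod.stdAddChar_apply, ZMod.toCircle_apply, rad]

lemma sum_stdAddChar_pow_mul_conj_pow {N : ℕ} [NeZero N] {a b : ℕ} (ha : a < N) (hb : b < N) :
    ∑ z : ZMod N, (ZMod.stdAddChar z : ℂ) ^ a * (starRingEnd ℂ) (ZMod.stdAddChar z ^ b) =
      if a = b then (N : ℂ) else 0 := by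
  have h (z : ZMod N) : (ZMod.stdAddChar z : ℂ) ^ a * (starRingEnd ℂ) (ZMod.stdAddChar z ^ b) =
      ZMod.stdAddChar (z * ((a : ZMod N) - (b : ZMod N))) := by
    rw [map_pow, ← AddChar.map_neg_eq_conj, ← AddChar.map_nsmul_eq_pow, ← AddChar.map_nsmul_eq_pow,
      ← AddChar.map_add_eq_mul]
    congr 1
    simp only [nsmul_eq_mul]
    ring
  simp_rw [h]
  rw [AddChar.sum_mulShift _ (ZMod.isPrimitive_stdAddChar N), ZMod.card]
  have : (a : ZMod N) - (b : ZMod N) = 0 ↔ a = b := by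
    rw [sub_eq_zero, ZMod.natCast_eq_natCast_iff',
      Nat.mod_eq_of_lt ha, Nat.mod_eq_of_lt hb]
  simp [this]

/-- `ψ_l ψ̄_i` as a function of the first `N` coordinates. -/
lemma psi_mul_conj_psi (hm : ∀ k, 2 ≤ m k) [∀ k, NeZero (m k)] {l i N : ℕ} (hl : l < Mseq m N)
    (hi : i < Mseq m N) (x : Gm m) :
    psi m l x * (starRingEnd ℂ) (psi m i x) =
      ∏ k : Fin N, ((ZMod.stdAddChar (firstCoords m N x k) : ℂ) ^ digit m l k *
        (starRingEnd ℂ) (ZMod.stdAddChar (firstCoords m N x k) ^ digit m i k)) := by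
  rw [psi_eq_prod_fin hm hl, psi_eq_prod_fin hm hi, map_prod, ← prod_mul_distrib]
  simp only [rad_eq_stdAddChar, firstCoords]

lemma IsHaarGm.integrable_psi_mul_conj_psi (hm : ∀ k, 2 ≤ m k) {μ : Measure (Gm m)}
    (hμ : IsHaarGm m μ) (l i : ℕ) :
    Integrable (fun x => psi m l x * (starRingEnd ℂ) (psi m i x)) μ := by
  have (k : ℕ) : NeZero (m k) := ⟨by have := hm k; omega⟩
  have hl : l < Mseq m (l + i) := lt_of_le_of_lt (by omega) (lt_Mseq hm (l + i))
  have hi : i < Mseq m (l + i) := lt_of_le_of_lt (by omega) (lt_Mseq hm (l + i))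
  simp_rw [psi_mul_conj_psi hm hl hi]
  exact hμ.integrable_comp_firstCoords (l + i) fun y => ∏ k : Fin (l + i),
    ((ZMod.stdAddChar (y k) : ℂ) ^ digit m l k *
      (starRingEnd ℂ) (ZMod.stdAddChar (y k) ^ digit m i k))

/-- The Vilenkin system is orthonormal. -/
lemma IsHaarGm.integral_psi_mul_conj_psi (hm : ∀ k, 2 ≤ m k) {μ : Measure (Gm m)}
    (hμ : IsHaarGm m μ) (l i : ℕ) :
    ∫ x, psi m l x * (starRingEnd ℂ) (psi m i x) ∂μ = if l = i then 1 else 0 := by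
  have (k : ℕ) : NeZero (m k) := ⟨by have := hm k; omega⟩
  obtain ⟨N, hl, hi⟩ : ∃ N, l < Mseq m N ∧ i < Mseq m N :=
    ⟨l + i, lt_of_le_of_lt (by omega) (lt_Mseq hm (l + i)),
      lt_of_le_of_lt (by omega) (lt_Mseq hm (l + i))⟩
  simp_rw [psi_mul_conj_psi hm hl hi]
  rw [hμ.integral_comp_firstCoords N fun y => ∏ k : Fin N,
    ((ZMod.stdAddChar (y k) : ℂ) ^ digit m l k *
      (starRingEnd ℂ) (ZMod.stdAddChar (y k) ^ digit m i k))]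
  rw [← Fintype.prod_sum fun (k : Fin N) (z : ZMod (m k)) =>
    (ZMod.stdAddChar z : ℂ) ^ digit m l k * (starRingEnd ℂ) (ZMod.stdAddChar z ^ digit m i k)]
  simp_rw [sum_stdAddChar_pow_mul_conj_pow (digit_lt hm l _) (digit_lt hm i _)]
  split_ifs with h
  · subst h
    have hM : (Mseq m N : ℂ) ≠ 0 := by exact_mod_cast (Mseq_pos hm N).ne'
    simp only [if_true]
    rw [Fin.prod_univ_eq_prod_range (fun k => (m k : ℂ)), ← Nat.cast_prod, prod_range_eq_Mseq,
      inv_mul_cancel₀ hM]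
  · obtain ⟨k, hk, hne⟩ := exists_digit_ne hl hi h
    rw [prod_eq_zero (mem_univ (⟨k, hk⟩ : Fin N)) (by simp [hne]), mul_zero]

end Orthonormality

section Coefficients

variable {m : ℕ → ℕ}

lemma Dker_sub_Dker {a b : ℕ} (h : a ≤ b) (x : Gm m) :
    Dker m b x - Dker m a x = ∑ l ∈ Ico a b, psi m l x := by
  rw [Dker, Dker, sum_Ico_eq_sub _ h]

lemma fCon_eq_sum {α : ℕ → ℕ} (hα : StrictMono α) (MM : ℕ) (p : ℝ) (Φ : ℕ → ℝ) (A : ℕ)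
    (x : Gm m) :
    fCon m MM p Φ α A x =
      ∑ k ∈ range A with α k < A, (lamSeq m Φ α k : ℂ) * atomFun m MM p (α k) x := by
  refine finsum_cond_eq_sum_of_cond_iff _ fun {k} _ => ?_
  have := hα.id_le k
  simp only [id_eq] at this
  simp only [mem_filter, mem_range, iff_and_self]
  omega

lemma IsHaarGm.fourierCoefFn_fCon (hm : ∀ k, 2 ≤ m k) {μ : Measure (Gm m)} (hμ : IsHaarGm m μ)
    {α : ℕ → ℕ} (hα : StrictMono α) (MM : ℕ) (p : ℝ) (Φ : ℕ → ℝ) {A k l : ℕ} (hk : α k < A)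
    (hl : l ∈ Ico (Mseq m (α k)) (Mseq m (α k + 1))) :
    fourierCoefFn m μ (fCon m MM p Φ α A) l =
      ((lamSeq m Φ α k * ((Mseq m (α k) : ℝ) ^ (1 / p - 1) / MM) : ℝ) : ℂ) := by
  have hM := (Mseq_strictMono hm).monotone
  have hexp (x : Gm m) : fCon m MM p Φ α A x * (starRingEnd ℂ) (psi m l x) =
      ∑ j ∈ range A with α j < A, ∑ i ∈ Ico (Mseq m (α j)) (Mseq m (α j + 1)),
        ((lamSeq m Φ α j * ((Mseq m (α j) : ℝ) ^ (1 / p - 1) / MM) : ℝ) : ℂ) *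
          (psi m i x * (starRingEnd ℂ) (psi m l x)) := by
    rw [fCon_eq_sum hα, sum_mul]
    refine sum_congr rfl fun j _ => ?_
    rw [atomFun, Dker_sub_Dker (hM (Nat.le_succ _)), ← mul_sum, ← sum_mul]
    push_cast
    ring
  have hint (j i : ℕ) := (hμ.integrable_psi_mul_conj_psi hm i l).const_mul
    ((lamSeq m Φ α j * ((Mseq m (α j) : ℝ) ^ (1 / p - 1) / MM) : ℝ) : ℂ)
  simp_rw [fourierCoefFn, hexp]
  rw [integral_finsetSum _ fun j _ => integrable_finsetSum _ fun i _ => hint j i]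
  simp_rw [integral_finsetSum _ fun i _ => hint _ i, integral_const_mul,
    hμ.integral_psi_mul_conj_psi hm, mul_ite, mul_one, mul_zero, sum_ite_eq']
  rw [sum_eq_single_of_mem k]
  · rw [if_pos hl]
  · have := hα.id_le k
    simp only [id_eq] at this
    simp only [mem_filter, mem_range]
    omega
  · intro j _ hjk
    rw [if_neg]
    intro hj
    rw [mem_Ico] at hl hj
    rcases lt_or_gt_of_ne (hα.injective.ne hjk) with h | h
    · exact absurd (hM (Nat.succ_le_of_lt h)) (by simp only [Nat.succ_eq_add_one]; omega)
    · exact absurd (hM (Nat.succ_le_of_lt h)) (by simp only [Nat.succ_eq_add_one]; omega)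

end Coefficients

/-- Each term of a Vilenkin block is at least a fixed multiple of `φ ^ (1 / 2) / X`. -/
lemma block_term_lower_bound {p φ φ₀ K X y v : ℝ} (hp0 : 0 < p) (hp2 : p ≤ 2) (hφ₀ : 0 < φ₀)
    (hφ : φ₀ ≤ φ) (hK : 0 < K) (hX : 0 < X) (hy : 0 < y) (hyX : y ≤ K * X) (hv : φ ≤ v) :
    φ₀ ^ (1 / 2 - p / 4) / K ^ 2 * φ ^ (1 / 2 : ℝ) / X ≤
      (φ ^ (-(1 / 4 : ℝ)) * (X ^ (1 / p - 1) / K)) ^ p * v / y ^ (2 - p) := by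
  have hφp : 0 < φ := hφ₀.trans_le hφ
  have hvp : 0 < v := hφp.trans_le hv
  have h1 : (φ ^ (-(1 / 4 : ℝ)) * (X ^ (1 / p - 1) / K)) ^ p =
      φ ^ (-(p / 4)) * (X ^ (1 - p) / K ^ p) := by
    rw [Real.mul_rpow (by positivity) (by positivity), Real.div_rpow (by positivity) hK.le,
      ← Real.rpow_mul hφp.le, ← Real.rpow_mul hX.le]
    congr 2
    · ring
    · congr 1
      field_simp
  have h2 : y ^ (2 - p) ≤ K ^ (2 - p) * X ^ (2 - p) := by
    rw [← Real.mul_rpow hK.le hX.le]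
    exact Real.rpow_le_rpow hy.le hyX (by linarith)
  have h3 : φ₀ ^ (1 / 2 - p / 4) ≤ φ ^ (1 / 2 - p / 4) :=
    Real.rpow_le_rpow hφ₀.le hφ (by linarith)
  have h4 : φ ^ (1 / 2 - p / 4) * φ ^ (1 / 2 : ℝ) = φ ^ (-(p / 4)) * φ := by
    rw [← Real.rpow_add hφp, ← Real.rpow_add_one hφp.ne']
    congr 1
    ring
  have hXX : X ^ (2 - p) = X ^ (1 - p) * X := by
    rw [← Real.rpow_add_one hX.ne']
    congr 1
    ring
  have hKK : K ^ p * K ^ (2 - p) = K ^ 2 := by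
    rw [← Real.rpow_add hK, ← Real.rpow_natCast]
    congr 1
    push_cast
    ring
  calc φ₀ ^ (1 / 2 - p / 4) / K ^ 2 * φ ^ (1 / 2 : ℝ) / X
      ≤ φ ^ (1 / 2 - p / 4) / K ^ 2 * φ ^ (1 / 2 : ℝ) / X := by gcongr
    _ = φ ^ (-(p / 4)) * φ / K ^ 2 / X := by rw [← h4]; ring
    _ = φ ^ (-(p / 4)) * (X ^ (1 - p) / K ^ p) * φ / (K ^ (2 - p) * X ^ (2 - p)) := by
      rw [← hKK, hXX]
      have : X ^ (1 - p) ≠ 0 := by positivity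
      field_simp
    _ ≤ φ ^ (-(p / 4)) * (X ^ (1 - p) / K ^ p) * v / y ^ (2 - p) := by gcongr
    _ = _ := by rw [h1]

theorem statement12 (m : ℕ → ℕ) (hm : ∀ k, 2 ≤ m k)
    (MM : ℕ) (hMM : IsLUB (Set.range m) MM)
    (μ : Measure (Gm m)) (hμ : IsHaarGm m μ)
    (p : ℝ) (hp0 : 0 < p) (hp2 : p ≤ 2)
    (Φ : ℕ → ℝ) (hΦpos : ∀ n, 0 < Φ n) (hΦmono : Monotone Φ)
    (hΦtop : Tendsto Φ atTop atTop)
    (α : ℕ → ℕ) (hα : StrictMono α) (hα2 : ∀ k, 2 ≤ α k)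
    (hsum : Summable fun k => Φ (Mseq m (α k)) ^ (-(p / 4) : ℝ))
    (c : ℕ → ℂ)
    (hc : ∀ i, Tendsto (fun k => fourierCoefFn m μ (fCon m MM p Φ α k) i) atTop (nhds (c i))) :
    (∃ C : ℝ, 0 < C ∧ ∀ k : ℕ,
      C * Φ (Mseq m (α k)) ^ ((1 : ℝ) / 2) ≤
        ∑ l ∈ Finset.Ico 1 (Mseq m (α k + 1)), ‖c l‖ ^ p * Φ l / (l : ℝ) ^ (2 - p)) ∧
    ∑' l : ℕ, ENNReal.ofReal (‖c (l + 1)‖ ^ p * Φ (l + 1) / ((l + 1 : ℝ) ^ (2 - p))) = ⊤ := by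
  set F : ℕ → ℝ := fun l => ‖c l‖ ^ p * Φ l / (l : ℝ) ^ (2 - p) with hF
  have hF0 (l : ℕ) : 0 ≤ F l := by
    have := hΦpos l
    positivity
  have hmMM (k : ℕ) : m k ≤ MM := hMM.1 (Set.mem_range_self k)
  have hMM0 : (0 : ℝ) < MM := by
    have := (hm 0).trans (hmMM 0)
    exact_mod_cast (by omega : 0 < MM)
  have hcoef (k l : ℕ) (hl : l ∈ Ico (Mseq m (α k)) (Mseq m (α k + 1))) :
      c l = ((lamSeq m Φ α k * ((Mseq m (α k) : ℝ) ^ (1 / p - 1) / MM) : ℝ) : ℂ) := by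
    refine tendsto_nhds_unique (hc l) (tendsto_const_nhds.congr' ?_)
    filter_upwards [eventually_gt_atTop (α k)] with A hA
    exact (hμ.fourierCoefFn_fCon hm hα MM p Φ hA hl).symm
  set C : ℝ := Φ 0 ^ (1 / 2 - p / 4) / (MM : ℝ) ^ 2 with hC
  have hC0 : 0 < C := by
    have := hΦpos 0
    positivity
  have hbound (k : ℕ) : C * Φ (Mseq m (α k)) ^ ((1 : ℝ) / 2) ≤
      ∑ l ∈ Finset.Ico 1 (Mseq m (α k + 1)), F l := by
    have hX : (0 : ℝ) < Mseq m (α k) := by exact_mod_cast Mseq_pos hm (α k)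
    have hterm : ∀ l ∈ Ico (Mseq m (α k)) (Mseq m (α k + 1)),
        C * Φ (Mseq m (α k)) ^ ((1 : ℝ) / 2) / Mseq m (α k) ≤ F l := by
      intro l hl
      have hl' := mem_Ico.1 hl
      have hl1 : (l : ℝ) ≤ MM * Mseq m (α k) := by
        have := hl'.2.le.trans (Nat.mul_le_mul_right (Mseq m (α k)) (hmMM (α k)))
        exact_mod_cast this
      have hl0 : (0 : ℝ) < l := by exact_mod_cast (Mseq_pos hm (α k)).trans_le hl'.1
      have hlam : 0 ≤ lamSeq m Φ α k := Real.rpow_nonneg (hΦpos _).le _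
      simp only [hF]
      rw [hcoef k l hl, Complex.norm_real, Real.norm_of_nonneg (by positivity)]
      exact block_term_lower_bound hp0 hp2 (hΦpos 0) (hΦmono (Nat.zero_le _)) hMM0 hX hl0 hl1
        (hΦmono hl'.1)
    have hcard : (Mseq m (α k) : ℝ) ≤ #(Ico (Mseq m (α k)) (Mseq m (α k + 1))) := by
      rw [Nat.card_Ico, Mseq_succ]
      have := Nat.mul_le_mul_right (Mseq m (α k)) (hm (α k))
      exact_mod_cast (by omega : Mseq m (α k) ≤ m (α k) * Mseq m (α k) - Mseq m (α k))
    have hnn : 0 ≤ C * Φ (Mseq m (α k)) ^ ((1 : ℝ) / 2) / Mseq m (α k) := by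
      have := hΦpos (Mseq m (α k))
      positivity
    calc C * Φ (Mseq m (α k)) ^ ((1 : ℝ) / 2)
        = Mseq m (α k) * (C * Φ (Mseq m (α k)) ^ ((1 : ℝ) / 2) / Mseq m (α k)) := by field_simp
      _ ≤ #(Ico (Mseq m (α k)) (Mseq m (α k + 1))) *
          (C * Φ (Mseq m (α k)) ^ ((1 : ℝ) / 2) / Mseq m (α k)) := by gcongr
      _ ≤ ∑ l ∈ Ico (Mseq m (α k)) (Mseq m (α k + 1)), F l := by
        rw [← nsmul_eq_mul]
        exact card_nsmul_le_sum _ _ _ hterm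
      _ ≤ ∑ l ∈ Ico 1 (Mseq m (α k + 1)), F l :=
        sum_le_sum_of_subset_of_nonneg (Ico_subset_Ico_left (Mseq_pos hm (α k)))
          fun l _ _ => hF0 l
  refine ⟨⟨C, hC0, hbound⟩, ?_⟩
  have hdiv : Tendsto (fun k => C * Φ (Mseq m (α k)) ^ ((1 : ℝ) / 2)) atTop atTop :=
    ((tendsto_rpow_atTop (by norm_num)).comp (hΦtop.comp
      ((Mseq_strictMono hm).comp hα).tendsto_atTop)).const_mul_atTop hC0
  refine top_le_iff.1 (le_of_tendsto' (ENNReal.tendsto_ofReal_atTop.comp hdiv) fun k => ?_)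
  calc ENNReal.ofReal (C * Φ (Mseq m (α k)) ^ ((1 : ℝ) / 2))
      ≤ ENNReal.ofReal (∑ l ∈ Ico 1 (Mseq m (α k + 1)), F l) := ENNReal.ofReal_le_ofReal (hbound k)
    _ = ∑ l ∈ range (Mseq m (α k + 1) - 1), ENNReal.ofReal (F (l + 1)) := by
      rw [ENNReal.ofReal_sum_of_nonneg fun l _ => hF0 l, sum_Ico_eq_sum_range]
      simp only [add_comm 1]
    _ ≤ ∑' l : ℕ, ENNReal.ofReal (F (l + 1)) := ENNReal.sum_le_tsum _
    _ = _ := by simp only [hF, Nat.cast_add, Nat.cast_one]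

end VilenkinPaper
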